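/- Per-excursion cost of several wasted excursions (Lemma 4.4): Assume V satisfies Assumption 1. There exists C < ∞ such that for every M < ∞, every δ ∈ (0, 1/2) and every integer m ≥ 1 there exists ℓ* < ∞ with the following property. For all ℓ₁, ℓ₂ ≥ ℓ* and all u₋, u₊ ∈ [−M, M], let A^bc be the set of continuously differentiable u : ℝ → ℝ with u(−ℓ₁−ℓ₂) = u₋ and u(ℓ₁+ℓ₂) = u₊, and let A₀^bc be the set of u ∈ A^bc possessing m disjoint wasted δ⁻ excursions in (−ℓ₁, ℓ₁), i.e. there exist points x₋¹ < x₀¹ < x₊¹ ≤ x₋² < x₀² < x₊² ≤ … ≤ x₋ᵐ < x₀ᵐ < x₊ᵐ, all in [−ℓ₁, ℓ₁], such that each triple (x₋ⁱ, x₀ⁱ, x₊ⁱ) is a wasted δ⁻ excursion of u. Then inf_{u ∈ A₀^bc} E_{(−ℓ₁−ℓ₂, ℓ₁+ℓ₂)}(u) − inf_{u ∈ A^bc} E_{(−ℓ₁−ℓ₂, ℓ₁+ℓ₂)}(u) ≤ m·(c₀ + C·δ). -/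

import Mathlib

open MeasureTheory

/-- Assumption 1: `V` is smooth, even, nonnegative, and on `(0,∞)` it vanishes only at `1`,
its derivative vanishes only at `1`, `V''(1) > 0`, and `V` grows at least like `u^{1+β}`. -/
structure Assumption1 (V : ℝ → ℝ) : Prop where
  smooth : ContDiff ℝ (⊤ : ℕ∞) V
  even : ∀ u : ℝ, V (-u) = V u
  nonneg : ∀ u : ℝ, 0 ≤ V u
  zero_iff : ∀ u : ℝ, 0 < u → (V u = 0 ↔ u = 1)
  deriv_zero_iff : ∀ u : ℝ, 0 < u → (deriv V u = 0 ↔ u = 1)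
  second_deriv_pos : 0 < deriv (deriv V) 1
  growth : ∃ C : ℝ, 0 < C ∧ ∃ β : ℝ, 0 < β ∧ ∀ u : ℝ, C ≤ u → u ^ (1 + β) / C ≤ V u

/-- The energy of `u` on `(a,b)`: `E_{(a,b)}(u) = ∫_a^b ((1/2) u'² + V(u))`. -/
noncomputable def energy (V : ℝ → ℝ) (a b : ℝ) (u : ℝ → ℝ) : ℝ :=
  ∫ x in a..b, ((1/2) * (deriv u x)^2 + V (u x))

/-- The transition energy `c₀ = ∫_{-1}^{1} √(2 V(s)) ds`. -/
noncomputable def c0 (V : ℝ → ℝ) : ℝ := ∫ s in (-1:ℝ)..1, Real.sqrt (2 * V s)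

/-- The triple `(xm, x0, xp)` is a wasted `δ⁻` excursion of `u`. -/
def IsWastedMinusTriple (δ : ℝ) (u : ℝ → ℝ) (xm x0 xp : ℝ) : Prop :=
  |u x0| ≤ δ ∧
    ((|u xm - 1| ≤ δ ∧ |u xp - 1| ≤ δ) ∨ (|u xm + 1| ≤ δ ∧ |u xp + 1| ≤ δ))

def IsPath (V : ℝ → ℝ) (a b p s q t e : ℝ) (w : ℝ → ℝ) : Prop :=
  ContDiff ℝ 1 w ∧ w a = p ∧ deriv w a = s ∧ w b = q ∧ deriv w b = t ∧ energy V a b w ≤ e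

lemma dens_cont {V : ℝ → ℝ} (hV : Continuous V) {u : ℝ → ℝ} (hu : ContDiff ℝ 1 u) :
    Continuous (fun x => (1/2) * (deriv u x)^2 + V (u x)) := by
  have h1 : Continuous (deriv u) := hu.continuous_deriv le_rfl
  have h2 := hu.continuous
  fun_prop

lemma glue {u v : ℝ → ℝ} {c : ℝ} (hu : ContDiff ℝ 1 u) (hv : ContDiff ℝ 1 v)
    (h0 : u c = v c) (h1 : deriv u c = deriv v c) :
    ∃ w : ℝ → ℝ, ContDiff ℝ 1 w ∧ (∀ x ≤ c, w x = u x) ∧ (∀ x, c ≤ x → w x = v x) ∧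
      (∀ x ≤ c, deriv w x = deriv u x) ∧ (∀ x, c ≤ x → deriv w x = deriv v x) := by
  classical
  have hud : ∀ x, HasDerivAt u (deriv u x) x := fun x =>
    ((hu.differentiable one_ne_zero) x).hasDerivAt
  have hvd : ∀ x, HasDerivAt v (deriv v x) x := fun x =>
    ((hv.differentiable one_ne_zero) x).hasDerivAt
  set w : ℝ → ℝ := fun x => if x ≤ c then u x else v x with hw
  have wl : ∀ x ≤ c, w x = u x := fun x hx => by simp [hw, hx]
  have wr : ∀ x, c ≤ x → w x = v x := fun x hx => by
    rcases hx.eq_or_lt with rfl | hx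
    · simp [hw, h0]
    · simp [hw, not_le.mpr hx]
  have key : ∀ x, HasDerivAt w (if x ≤ c then deriv u x else deriv v x) x := by
    intro x
    rcases lt_trichotomy x c with hx | rfl | hx
    · rw [if_pos hx.le]
      refine (hud x).congr_of_eventuallyEq ?_
      filter_upwards [Iio_mem_nhds hx] with y hy using wl y (le_of_lt hy)
    · rw [if_pos le_rfl]
      have e1 : HasDerivWithinAt w (deriv u x) (Set.Iic x) x :=
        (hud x).hasDerivWithinAt.congr (fun y hy => wl y hy) (wl x le_rfl)
      have e2 : HasDerivWithinAt w (deriv u x) (Set.Ici x) x := by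
        rw [h1]
        exact (hvd x).hasDerivWithinAt.congr (fun y hy => wr y hy) (wr x le_rfl)
      have := e1.union e2
      rwa [Set.Iic_union_Ici, hasDerivWithinAt_univ] at this
    · rw [if_neg (not_le.mpr hx)]
      refine (hvd x).congr_of_eventuallyEq ?_
      filter_upwards [Ioi_mem_nhds hx] with y hy using wr y (le_of_lt hy)
  have dw : deriv w = fun x => if x ≤ c then deriv u x else deriv v x :=
    funext fun x => (key x).deriv
  refine ⟨w, ?_, wl, wr, ?_, ?_⟩
  · rw [contDiff_one_iff_deriv]
    refine ⟨fun x => (key x).differentiableAt, ?_⟩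
    rw [dw]
    refine Continuous.if_le (hu.continuous_deriv le_rfl) (hv.continuous_deriv le_rfl)
      continuous_id continuous_const ?_
    intro x hx
    rw [hx, h1]
  · intro x hx; simp [dw, hx]
  · intro x hx
    rcases hx.eq_or_lt with rfl | hx
    · simp [dw, h1]
    · simp [dw, not_le.mpr hx]

lemma energy_congr {V u v : ℝ → ℝ} {a b : ℝ} (hab : a ≤ b)
    (h : ∀ x, a ≤ x → x ≤ b → u x = v x ∧ deriv u x = deriv v x) :
    energy V a b u = energy V a b v := by
  unfold energy
  apply intervalIntegral.integral_congr
  intro x hx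
  rw [Set.uIcc_of_le hab] at hx
  obtain ⟨h1, h2⟩ := h x hx.1 hx.2
  simp only [h1, h2]

lemma energy_add {V : ℝ → ℝ} (hV : Continuous V) {u : ℝ → ℝ} (hu : ContDiff ℝ 1 u) (a b c : ℝ) :
    energy V a b u + energy V b c u = energy V a c u :=
  intervalIntegral.integral_add_adjacent_intervals
    ((dens_cont hV hu).intervalIntegrable _ _) ((dens_cont hV hu).intervalIntegrable _ _)

lemma energy_nonneg {V : ℝ → ℝ} (hV : ∀ u, 0 ≤ V u) {a b : ℝ} (hab : a ≤ b) (u : ℝ → ℝ) :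
    0 ≤ energy V a b u :=
  intervalIntegral.integral_nonneg hab fun x _ => by have := hV (u x); positivity

lemma IsPath.trans {V : ℝ → ℝ} (hV : Continuous V) {a c b p s q t r z e₁ e₂ : ℝ} {u v : ℝ → ℝ}
    (hac : a ≤ c) (hcb : c ≤ b)
    (hu : IsPath V a c p s q t e₁ u) (hv : IsPath V c b q t r z e₂ v) :
    ∃ w, IsPath V a b p s r z (e₁ + e₂) w ∧ (∀ x ≤ c, w x = u x) ∧ (∀ x, c ≤ x → w x = v x) := by
  obtain ⟨u1, u2, u3, u4, u5, u6⟩ := hu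
  obtain ⟨v1, v2, v3, v4, v5, v6⟩ := hv
  obtain ⟨w, hw, wl, wr, dl, dr⟩ := glue u1 v1 (u4.trans v2.symm) (u5.trans v3.symm)
  refine ⟨w, ⟨hw, ?_, ?_, ?_, ?_, ?_⟩, wl, wr⟩
  · rw [wl a hac, u2]
  · rw [dl a hac, u3]
  · rw [wr b hcb, v4]
  · rw [dr b hcb, v5]
  · rw [← energy_add hV hw a c b,
      energy_congr hac (fun x _ h => ⟨wl x h, dl x h⟩),
      energy_congr hcb (fun x h _ => ⟨wr x h, dr x h⟩)]
    linarith

lemma IsPath.shift {V : ℝ → ℝ} {a b p s q t e : ℝ} {u : ℝ → ℝ} (τ : ℝ)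
    (hu : IsPath V a b p s q t e u) :
    IsPath V (a + τ) (b + τ) p s q t e (fun x => u (x - τ)) := by
  obtain ⟨u1, u2, u3, u4, u5, u6⟩ := hu
  have hd : ∀ x, deriv (fun x => u (x - τ)) x = deriv u (x - τ) := fun x =>
    deriv_comp_sub_const u τ x
  refine ⟨u1.comp (contDiff_id.sub contDiff_const), ?_, ?_, ?_, ?_, ?_⟩
  · simpa using u2
  · rw [hd]; simpa using u3
  · simpa using u4
  · rw [hd]; simpa using u5
  · unfold energy at *
    simp only [hd]
    rw [intervalIntegral.integral_comp_sub_right (fun x => (1/2) * (deriv u x)^2 + V (u x)) τ]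
    simpa using u6

lemma IsPath.shift0 {V : ℝ → ℝ} {T p s q t e : ℝ} {u : ℝ → ℝ} (τ : ℝ)
    (hu : IsPath V 0 T p s q t e u) :
    IsPath V τ (T + τ) p s q t e (fun x => u (x - τ)) := by
  have := hu.shift τ
  rwa [zero_add] at this

lemma IsPath.reverse {V : ℝ → ℝ} {T p s q t e : ℝ} {u : ℝ → ℝ}
    (hu : IsPath V 0 T p s q t e u) :
    IsPath V 0 T q (-t) p (-s) e (fun x => u (T - x)) := by
  obtain ⟨u1, u2, u3, u4, u5, u6⟩ := hu
  have hd : ∀ x, deriv (fun x => u (T - x)) x = - deriv u (T - x) := fun x =>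
    deriv_comp_const_sub u T x
  refine ⟨u1.comp (contDiff_const.sub contDiff_id), ?_, ?_, ?_, ?_, ?_⟩
  · simpa using u4
  · rw [hd]; simpa using u5
  · simpa using u2
  · rw [hd]; simpa using u3
  · unfold energy at *
    simp only [hd, neg_sq]
    rw [intervalIntegral.integral_comp_sub_left (fun x => (1/2) * (deriv u x)^2 + V (u x)) T]
    simpa using u6

lemma energy_neg {V : ℝ → ℝ} (hV : ∀ u, V (-u) = V u) (a b : ℝ) (u : ℝ → ℝ) :
    energy V a b (fun x => - u x) = energy V a b u := by
  unfold energy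
  have hd : ∀ x, deriv (fun x => - u x) x = - deriv u x := fun x => deriv.fun_neg
  simp only [hd, neg_sq, hV]

lemma IsPath.const {V : ℝ → ℝ} (h1 : V 1 = 0) (a b : ℝ) :
    IsPath V a b 1 0 1 0 0 (fun _ => 1) := by
  refine ⟨contDiff_const, rfl, by simp, rfl, by simp, ?_⟩
  simp [energy, h1]

lemma hermite {V : ℝ → ℝ} (hV : Continuous V) (p s q t h D B : ℝ) (hh : 0 < h)
    (hD : |s| + |t| + 2 * |q - p| / h ≤ D)
    (hB : ∀ v, |v - p| ≤ D * h → V v ≤ B) :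
    ∃ w, IsPath V 0 h p s q t (h * (1/2 * D^2 + B)) w := by
  set k := (q - p) / h with hk
  have hkD : |s| + |t| + 2 * |k| ≤ D := by
    have : 2 * |q - p| / h = 2 * |k| := by rw [hk, abs_div, abs_of_pos hh]; ring
    linarith
  set w : ℝ → ℝ := fun x => p + s * (x - 2 * x^2/h + x^3/h^2) + t * (x^3/h^2 - x^2/h)
    + 6 * k * (x^2/(2*h) - x^3/(3*h^2)) with hw
  set d : ℝ → ℝ := fun x => s * (1 - 4 * (x/h) + 3 * (x/h)^2) + t * (3 * (x/h)^2 - 2 * (x/h))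
    + 6 * k * ((x/h) - (x/h)^2) with hd
  have hder : ∀ x, HasDerivAt w (d x) x := by
    intro x
    have i1 := hasDerivAt_id x
    have i2 := (hasDerivAt_pow 2 x)
    have i3 := (hasDerivAt_pow 3 x)
    have := ((((i1.sub ((i2.const_mul 2).div_const h)).add (i3.div_const (h^2))).const_mul s).const_add p).add
      (((i3.div_const (h^2)).sub (i2.div_const h)).const_mul t) |>.add
      (((i2.div_const (2*h)).sub (i3.div_const (3*h^2))).const_mul (6*k))
    refine HasDerivAt.congr_deriv (f := w) this ?_
    simp only [hd]
    push_cast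
    field_simp
    ring
  have hdw : deriv w = d := funext fun x => (hder x).deriv
  have hdc : Continuous d := by simp only [hd]; fun_prop
  have hcd : ContDiff ℝ 1 w := by
    rw [contDiff_one_iff_deriv, hdw]
    exact ⟨fun x => (hder x).differentiableAt, hdc⟩
  have hbd : ∀ x ∈ Set.Icc 0 h, |d x| ≤ D := by
    intro x hx
    have y0 : 0 ≤ x / h := div_nonneg hx.1 hh.le
    have y1 : x / h ≤ 1 := (div_le_one hh).2 hx.2
    simp only [hd]
    set y := x / h
    have a1 : |1 - 4 * y + 3 * y^2| ≤ 1 := by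
      rw [abs_le]; constructor <;> nlinarith [sq_nonneg (3*y-2)]
    have a2 : |3 * y^2 - 2 * y| ≤ 1 := by
      rw [abs_le]; constructor <;> nlinarith [sq_nonneg (3*y-1)]
    have a3 : |6 * (y - y^2)| ≤ 2 := by
      rw [abs_le]; constructor <;> nlinarith [sq_nonneg (2*y-1)]
    have b1 : |s * (1 - 4 * y + 3 * y^2)| ≤ |s| := by
      rw [abs_mul]; exact mul_le_of_le_one_right (abs_nonneg _) a1
    have b2 : |t * (3 * y^2 - 2 * y)| ≤ |t| := by
      rw [abs_mul]; exact mul_le_of_le_one_right (abs_nonneg _) a2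
    have b3 : |6 * k * (y - y^2)| ≤ 2 * |k| := by
      have : 6 * k * (y - y^2) = k * (6 * (y - y^2)) := by ring
      rw [this, abs_mul, mul_comm 2]
      exact mul_le_mul_of_nonneg_left a3 (abs_nonneg _)
    refine (abs_add_three _ _ _).trans ?_
    linarith
  have D0 : 0 ≤ D := (abs_nonneg _).trans (hbd 0 ⟨le_rfl, hh.le⟩)
  have w0 : w 0 = p := by simp [hw]
  have hwb : ∀ x ∈ Set.Icc 0 h, |w x - p| ≤ D * h := by
    intro x hx
    have := Convex.norm_image_sub_le_of_norm_hasDerivWithin_le (f := w) (f' := d) (C := D)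
      (s := Set.Icc 0 h) (x := 0) (y := x) (fun y _ => (hder y).hasDerivWithinAt)
      (fun y hy => hbd y hy) (convex_Icc 0 h) ⟨le_rfl, hh.le⟩ hx
    rw [w0, Real.norm_eq_abs, Real.norm_eq_abs, sub_zero, abs_of_nonneg hx.1] at this
    exact this.trans (mul_le_mul_of_nonneg_left hx.2 D0)
  refine ⟨w, hcd, w0, ?_, ?_, ?_, ?_⟩
  · rw [hdw]; simp [hd]
  · simp only [hw, hk]; field_simp; ring
  · rw [hdw]; simp only [hd]; rw [div_self hh.ne']; ring
  · unfold energy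
    have := intervalIntegral.integral_mono_on (μ := volume) hh.le
      ((dens_cont hV hcd).intervalIntegrable 0 h)
      (intervalIntegrable_const (c := 1/2 * D^2 + B)) (fun x hx => by
        have h1 := hbd x hx
        have h2 := hB _ (hwb x hx)
        have h3 : (deriv w x)^2 ≤ D^2 := by
          rw [hdw]; exact sq_le_sq' (by linarith [(abs_le.1 h1).1]) (abs_le.1 h1).2
        show 1/2 * (deriv w x)^2 + V (w x) ≤ 1/2 * D^2 + B
        linarith)
    refine this.trans (le_of_eq ?_)
    rw [intervalIntegral.integral_const, smul_eq_mul]; ring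

lemma V_one {V : ℝ → ℝ} (hV : Assumption1 V) : V 1 = 0 := (hV.zero_iff 1 one_pos).2 rfl

lemma V_small {V : ℝ → ℝ} (hV : Assumption1 V) {δ : ℝ} (h0 : 0 < δ) (h1 : δ < 1/2) :
    ∃ κ > 0, ∀ v, V v < κ → |v - 1| ≤ δ ∨ |v + 1| ≤ δ := by
  have hc : Continuous V := hV.smooth.continuous
  have pos : ∀ v, 0 < v → v ≠ 1 → 0 < V v := fun v hv hn =>
    lt_of_le_of_ne (hV.nonneg v) fun h => hn ((hV.zero_iff v hv).1 h.symm)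
  refine ⟨min (V (1-δ)) (V (1+δ)), lt_min (pos _ (by linarith) (by linarith))
    (pos _ (by linarith) (by linarith)), ?_⟩
  have key : ∀ v, 0 ≤ v → V v < min (V (1-δ)) (V (1+δ)) → |v - 1| ≤ δ := by
    intro v hv hlt
    rw [lt_min_iff] at hlt
    by_contra hcon
    rw [abs_le, not_and_or, not_le, not_le] at hcon
    rcases hcon with hcon | hcon
    · obtain ⟨c, hc1, hc2⟩ := intermediate_value_Icc' (show 1 - δ ≤ 1 by linarith)
        hc.continuousOn (show V v ∈ Set.Icc (V 1) (V (1-δ)) from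
          ⟨by rw [V_one hV]; exact hV.nonneg v, hlt.1.le⟩)
      obtain ⟨z, hz, hz0⟩ := exists_deriv_eq_zero (show v < c by linarith [hc1.1])
        hc.continuousOn hc2.symm
      have := (hV.deriv_zero_iff z (by linarith [hz.1])).1 hz0
      linarith [hz.2, hc1.2]
    · obtain ⟨c, hc1, hc2⟩ := intermediate_value_Icc (show 1 ≤ 1 + δ by linarith)
        hc.continuousOn (show V v ∈ Set.Icc (V 1) (V (1+δ)) from
          ⟨by rw [V_one hV]; exact hV.nonneg v, hlt.2.le⟩)
      obtain ⟨z, hz, hz0⟩ := exists_deriv_eq_zero (show c < v by linarith [hc1.2])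
        hc.continuousOn hc2
      have := (hV.deriv_zero_iff z (by linarith [hz.1, hc1.1])).1 hz0
      linarith [hz.1, hc1.1]
  intro v hv
  rcases le_total 0 v with h | h
  · exact Or.inl (key v h hv)
  · right
    have := key (-v) (by linarith) (by rwa [hV.even])
    rw [← abs_neg]; convert this using 2; ring

lemma V_lip {V : ℝ → ℝ} (hV : Assumption1 V) :
    ∃ L > 0, ∀ v, |v - 1| ≤ 2 → V v ≤ L * |v - 1| := by
  have hdc : Continuous (deriv V) := hV.smooth.continuous_deriv (by norm_cast)
  have hdiff : Differentiable ℝ V := hV.smooth.differentiable (by simp)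
  obtain ⟨L, hL⟩ := (isCompact_Icc (a := (-1:ℝ)) (b := 3)).exists_bound_of_continuousOn
    hdc.continuousOn
  refine ⟨|L| + 1, by positivity, fun v hv => ?_⟩
  rw [abs_le] at hv
  have := Convex.norm_image_sub_le_of_norm_deriv_le (f := V) (C := |L| + 1)
      (s := Set.Icc (-1) 3) (x := 1) (y := v) (fun y _ => hdiff y)
      (fun y hy => (hL y hy).trans ((le_abs_self L).trans (by linarith))) (convex_Icc _ _)
      (by constructor <;> norm_num) ⟨by linarith, by linarith⟩
  rw [V_one hV, sub_zero] at this
  exact (le_abs_self _).trans this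

lemma V_bdd {V : ℝ → ℝ} (hV : Continuous V) (R : ℝ) :
    ∃ B ≥ 0, ∀ v, |v| ≤ R → V v ≤ B := by
  obtain ⟨L, hL⟩ := (isCompact_Icc (a := -R) (b := R)).exists_bound_of_continuousOn
    hV.continuousOn
  exact ⟨|L|, abs_nonneg _, fun v hv => (le_abs_self _).trans
    ((hL v (abs_le.1 hv)).trans (le_abs_self L))⟩

lemma half_path {V : ℝ → ℝ} (hV : Assumption1 V) {ε : ℝ} (hε : 0 < ε) :
    ∃ T > 0, ∃ w, IsPath V 0 T 0 (√(2 * V 0) + ε) 1 ε (c0 V / 2 + ε) w := by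
  have hc : Continuous V := hV.smooth.continuous
  set f : ℝ → ℝ := fun s => √(2 * V (max 0 (min s 1))) with hf
  have hfc : Continuous f := by simp only [hf]; fun_prop
  have hf0 : ∀ s, 0 ≤ f s := fun s => Real.sqrt_nonneg _
  set g : ℝ → ℝ := fun s => f s + ε with hg
  have hgc : Continuous g := by simp only [hg]; fun_prop
  have hgp : ∀ s, 0 < g s := fun s => by have := hf0 s; simp only [hg]; linarith
  have hgic : Continuous (fun s => (g s)⁻¹) := hgc.inv₀ fun s => (hgp s).ne'
  -- bound
  obtain ⟨R, hR0, hR⟩ : ∃ R > 0, ∀ s, g s ≤ R := by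
    obtain ⟨B, hB0, hB⟩ := V_bdd hc 1
    refine ⟨√(2 * B) + ε, by positivity, fun s => ?_⟩
    simp only [hg, hf]
    gcongr
    apply hB
    rw [abs_of_nonneg (le_max_left _ _)]
    exact max_le (by norm_num) (min_le_right _ _)
  set G : ℝ → ℝ := fun w => ∫ s in (0:ℝ)..w, (g s)⁻¹ with hG
  have hGd : ∀ x, HasDerivAt G (g x)⁻¹ x := fun x =>
    intervalIntegral.integral_hasDerivAt_right (hgic.intervalIntegrable _ _)
      (hgic.stronglyMeasurableAtFilter _ _) hgic.continuousAt
  have hGm : StrictMono G := strictMono_of_deriv_pos fun x => by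
    rw [(hGd x).deriv]; exact inv_pos.2 (hgp x)
  have hGc : Continuous G := continuous_iff_continuousAt.2 fun x => (hGd x).continuousAt
  have hinc : ∀ x y, x ≤ y → R⁻¹ * (y - x) ≤ G y - G x := fun x y hxy => by
    have := Convex.mul_sub_le_image_sub_of_le_deriv (f := G) (D := Set.univ) convex_univ
      hGc.continuousOn (fun x _ => (hGd x).differentiableAt.differentiableWithinAt) (C := R⁻¹)
      (fun x _ => by rw [(hGd x).deriv]; exact inv_anti₀ (hgp x) (hR x))
      x trivial y trivial hxy
    exact this
  have G0 : G 0 = 0 := by simp [hG]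
  have hGs : Function.Surjective G := by
    intro y
    have h1 : G (-(R * |y|)) ≤ y := by
      have := hinc (-(R * |y|)) 0 (by simp; positivity)
      rw [G0] at this
      have e : R⁻¹ * (0 - -(R * |y|)) = |y| := by field_simp; ring
      rw [e] at this
      linarith [neg_abs_le y]
    have h2 : y ≤ G (R * |y|) := by
      have := hinc 0 (R * |y|) (by positivity)
      rw [G0] at this
      have e : R⁻¹ * (R * |y| - 0) = |y| := by field_simp; ring
      rw [e] at this
      linarith [le_abs_self y]
    have hle : -(R * |y|) ≤ R * |y| := by
      have : 0 ≤ R * |y| := by positivity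
      linarith
    obtain ⟨x, _, hx⟩ := intermediate_value_Icc hle hGc.continuousOn ⟨h1, h2⟩
    exact ⟨x, hx⟩
  let Φ : ℝ ≃ₜ ℝ := (StrictMono.orderIsoOfSurjective G hGm hGs).toHomeomorph
  have hΦ : ∀ x, Φ x = G x := fun x => rfl
  have hΦd : ∀ x, HasDerivAt Φ (g x)⁻¹ x := hGd
  set W : ℝ → ℝ := fun x => Φ.symm x with hW
  have hWG : ∀ x, W (G x) = x := fun x => Φ.symm_apply_apply x
  have hGW : ∀ x, G (W x) = x := fun x => Φ.apply_symm_apply x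
  have hWc : Continuous W := Φ.symm.continuous
  have hWd : ∀ x, HasDerivAt W (g (W x)) x := by
    intro x
    have := HasDerivAt.of_local_left_inverse (f := G) (g := W) (a := x) hWc.continuousAt
      (hGd (W x)) (inv_ne_zero (hgp _).ne') (Filter.Eventually.of_forall hGW)
    simpa using this
  have hdW : deriv W = fun x => g (W x) := funext fun x => (hWd x).deriv
  have hWC : ContDiff ℝ 1 W := by
    rw [contDiff_one_iff_deriv, hdW]
    exact ⟨fun x => (hWd x).differentiableAt, hgc.comp hWc⟩
  have hT : 0 < G 1 := by rw [← G0]; exact hGm one_pos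
  have W0 : W 0 = 0 := by rw [← G0, hWG, G0]
  refine ⟨G 1, hT, W, hWC, W0, ?_, hWG 1, ?_, ?_⟩
  · rw [hdW]; simp [W0, hg, hf]
  · rw [hdW]; simp [hWG, hg, hf, V_one hV]
  · have hWmono : ∀ x ∈ Set.Icc 0 (G 1), W x ∈ Set.Icc (0:ℝ) 1 := by
      intro x hx
      constructor
      · rw [← hGm.le_iff_le, hGW, G0]; exact hx.1
      · rw [← hGm.le_iff_le, hGW]; exact hx.2
    have hfV : ∀ s ∈ Set.Icc (0:ℝ) 1, f s = √(2 * V s) := by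
      intro s hs
      simp only [hf]
      rw [min_eq_left hs.2, max_eq_right hs.1]
    have step1 : energy V 0 (G 1) W ≤ ∫ x in (0:ℝ)..(G 1), (g ∘ W) x * g (W x) := by
      unfold energy
      refine intervalIntegral.integral_mono_on hT.le
        ((dens_cont hc hWC).intervalIntegrable _ _)
        (((hgc.comp hWc).mul (hgc.comp hWc)).intervalIntegrable _ _) (fun x hx => ?_)
      have hs := hWmono x hx
      have e : V (W x) = (f (W x))^2 / 2 := by
        rw [hfV _ hs, Real.sq_sqrt (by have := hV.nonneg (W x); positivity)]; ring
      have h1 := hf0 (W x)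
      have h2 : f (W x) ≤ g (W x) := by simp only [hg]; linarith
      simp only [hdW, Function.comp]
      rw [e]
      nlinarith
    have step2 : ∫ x in (0:ℝ)..(G 1), (g ∘ W) x * g (W x) = ∫ s in (0:ℝ)..1, g s := by
      rw [intervalIntegral.integral_comp_mul_deriv (fun x _ => hWd x)
        (hgc.comp hWc).continuousOn hgc, W0, hWG]
    have step3 : ∫ s in (0:ℝ)..1, g s = (∫ s in (0:ℝ)..1, √(2 * V s)) + ε := by
      have : ∫ s in (0:ℝ)..1, g s = ∫ s in (0:ℝ)..1, (√(2 * V s) + ε) := by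
        apply intervalIntegral.integral_congr
        intro s hs
        rw [Set.uIcc_of_le zero_le_one] at hs
        simp only [hg, hfV s hs]
      rw [this, intervalIntegral.integral_add
        ((by fun_prop : Continuous fun s => √(2 * V s)).intervalIntegrable _ _)
        intervalIntegrable_const]
      simp
    have step4 : c0 V = 2 * ∫ s in (0:ℝ)..1, √(2 * V s) := by
      have hi : Continuous fun s => √(2 * V s) := by fun_prop
      unfold c0
      rw [← intervalIntegral.integral_add_adjacent_intervals (b := 0)
        (hi.intervalIntegrable _ _) (hi.intervalIntegrable _ _)]
      have : ∫ s in (-1:ℝ)..0, √(2 * V s) = ∫ s in (0:ℝ)..1, √(2 * V s) := by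
        have := intervalIntegral.integral_comp_neg (a := 0) (b := 1) (fun s => √(2 * V s))
        simp only [hV.even, neg_zero] at this
        exact this.symm
      rw [this]; ring
    rw [step2, step3] at step1
    linarith

lemma excursion {V : ℝ → ℝ} (hV : Assumption1 V) :
    ∃ K > 0, ∀ δ ∈ Set.Ioo (0:ℝ) (1/2), ∃ T x₀ w, 0 < x₀ ∧ x₀ < T ∧
      IsPath V 0 T 1 0 1 0 (c0 V + K * δ) w ∧ w x₀ = 0 := by
  have hc : Continuous V := hV.smooth.continuous
  obtain ⟨L, hL0, hL⟩ := V_lip hV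
  set D := 2 * (√(2 * V 0) + 1) with hD
  have hDp : 0 < D := by positivity
  obtain ⟨B, hB0, hB⟩ := V_bdd hc D
  refine ⟨2 + (1/2 * D^2 + B) + 2 * (1 + L), by positivity, ?_⟩
  rintro δ ⟨h0, h1⟩
  have hfix : ∀ v, |v - 1| ≤ δ * 1 → V v ≤ L * δ := fun v hv => by
    rw [mul_one] at hv
    exact (hL v (by linarith)).trans (mul_le_mul_of_nonneg_left hv hL0.le)
  obtain ⟨a1, ha1⟩ := hermite hc 1 0 1 (-δ) 1 δ (L * δ) one_pos
    (by simp [abs_of_pos h0]) hfix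
  obtain ⟨a5, ha5⟩ := hermite hc 1 δ 1 0 1 δ (L * δ) one_pos
    (by simp [abs_of_pos h0]) hfix
  set s := √(2 * V 0) + δ with hs
  have hsp : 0 < s := by positivity
  obtain ⟨a3, ha3⟩ := hermite hc 0 (-s) 0 s δ D B h0
    (by simp only [abs_neg, abs_of_pos hsp]; simp; linarith) (fun v hv => hB v (by
      rw [sub_zero] at hv
      exact hv.trans (by nlinarith)))
  obtain ⟨T, hT, a4, ha4⟩ := half_path hV h0
  rw [← hs] at ha4
  have ha2 := ha4.reverse
  obtain ⟨b1, hb1, -⟩ := ha1.trans hc zero_le_one (show 1 ≤ T + 1 by linarith) (ha2.shift0 1)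
  obtain ⟨b2, hb2, -⟩ := ha3.trans hc h0.le (show δ ≤ T + δ by linarith)
    (ha4.shift0 δ)
  obtain ⟨b3, hb3, -⟩ := hb2.trans hc (by linarith) (show T + δ ≤ 1 + (T + δ) by linarith)
    (ha5.shift0 (T + δ))
  obtain ⟨w, hw, hwl, -⟩ := hb1.trans hc (by linarith)
    (show T + 1 ≤ 1 + (T + δ) + (T + 1) by linarith) (hb3.shift0 (T + 1))
  refine ⟨_, T + 1, w, by linarith, by linarith, ⟨hw.1, hw.2.1, hw.2.2.1, hw.2.2.2.1,
    hw.2.2.2.2.1, hw.2.2.2.2.2.trans ?_⟩, ?_⟩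
  · nlinarith
  · rw [hwl _ le_rfl, hb1.2.2.2.1]

lemma multi {V : ℝ → ℝ} (hV : Assumption1 V) {T x₀ e : ℝ} {w : ℝ → ℝ} (h0 : 0 < x₀) (h1 : x₀ < T)
    (hw : IsPath V 0 T 1 0 1 0 e w) (hw0 : w x₀ = 0) (m : ℕ) :
    ∃ v, IsPath V 0 (m * T) 1 0 1 0 (m * e) v ∧
      ∀ i : ℕ, i < m → v (i * T) = 1 ∧ v (i * T + x₀) = 0 ∧ v ((i + 1) * T) = 1 := by
  have hc : Continuous V := hV.smooth.continuous
  have hT : 0 < T := h0.trans h1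
  induction m with
  | zero => exact ⟨fun _ => 1, by simpa using IsPath.const (V_one hV) 0 0, by simp⟩
  | succ m ih =>
    obtain ⟨v, hv, hvi⟩ := ih
    obtain ⟨z, hz, zl, zr⟩ := hv.trans hc (by positivity)
      (show m * T ≤ T + m * T by linarith) (hw.shift0 (m * T))
    refine ⟨z, ?_, ?_⟩
    · have e1 : ((m + 1 : ℕ) : ℝ) * T = T + m * T := by push_cast; ring
      have e2 : ((m + 1 : ℕ) : ℝ) * e = m * e + e := by push_cast; ring
      rw [e1, e2]; exact hz
    · intro i hi
      rcases (Nat.lt_succ_iff.1 hi).eq_or_lt with rfl | hi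
      · refine ⟨?_, ?_, ?_⟩
        · rw [zl _ le_rfl]; exact hv.2.2.2.1
        · rw [zr _ (by linarith)]; simpa using hw0
        · rw [show ((i:ℝ) + 1) * T = T + i * T by ring]; exact hz.2.2.2.1
      · obtain ⟨q1, q2, q3⟩ := hvi i hi
        have hi' : (i:ℝ) + 1 ≤ m := by exact_mod_cast hi
        have : ((i:ℝ) + 1) * T ≤ m * T := mul_le_mul_of_nonneg_right hi' hT.le
        refine ⟨?_, ?_, ?_⟩
        · rw [zl _ (by linarith)]; exact q1
        · rw [zl _ (by linarith)]; exact q2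
        · rw [zl _ (by linarith)]; exact q3

lemma match_path {V : ℝ → ℝ} (hV : Assumption1 V) : ∃ K > 0, ∀ δ ∈ Set.Ioo (0:ℝ) (1/2),
    ∀ p s, |p - 1| ≤ δ → |s| ≤ δ → ∃ w, IsPath V 0 1 1 0 p s (K * δ) w := by
  have hc : Continuous V := hV.smooth.continuous
  obtain ⟨L, hL0, hL⟩ := V_lip hV
  refine ⟨5 + 3 * L, by positivity, ?_⟩
  rintro δ ⟨h0, h1⟩ p s hp hs
  obtain ⟨w, hw⟩ := hermite hc 1 0 p s 1 (3 * δ) (L * (3 * δ)) one_pos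
    (by simp; linarith) (fun v hv => by
      rw [mul_one] at hv
      exact (hL v (by linarith)).trans (mul_le_mul_of_nonneg_left hv hL0.le))
  refine ⟨w, hw.1, hw.2.1, hw.2.2.1, hw.2.2.2.1, hw.2.2.2.2.1, hw.2.2.2.2.2.trans ?_⟩
  nlinarith

lemma replace_one {V : ℝ → ℝ} (hV : Assumption1 V) {K δ T x₀ e : ℝ} {w₀ : ℝ → ℝ}
    (hδ : 0 < δ)
    (hK : ∀ p s, |p - 1| ≤ δ → |s| ≤ δ → ∃ w, IsPath V 0 1 1 0 p s (K * δ) w)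
    (h0 : 0 < x₀) (h1 : x₀ < T)
    (hw : IsPath V 0 T 1 0 1 0 e w₀) (hw0 : w₀ x₀ = 0) (m : ℕ)
    {A B a b ℓ : ℝ} {u : ℝ → ℝ} (hu : ContDiff ℝ 1 u) (hA : A ≤ -ℓ) (ha : -ℓ ≤ a)
    (hab : a + (m * T + 2) ≤ b) (hb : b ≤ ℓ) (hB : ℓ ≤ B)
    (ua : |u a - 1| ≤ δ) (da : |deriv u a| ≤ δ) (ub : |u b - 1| ≤ δ) (db : |deriv u b| ≤ δ) :
    ∃ w : ℝ → ℝ, ContDiff ℝ 1 w ∧ w A = u A ∧ w B = u B ∧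
      (∃ xm x0 xp : ℕ → ℝ,
        (∀ i < m, -ℓ ≤ xm i ∧ xm i < x0 i ∧ x0 i < xp i ∧ xp i ≤ ℓ ∧
          IsWastedMinusTriple δ w (xm i) (x0 i) (xp i)) ∧
        (∀ i, i + 1 < m → xp i ≤ xm (i+1))) ∧
      energy V A B w ≤ energy V A B u + m * e + 2 * (K * δ) := by
  have hc : Continuous V := hV.smooth.continuous
  have hT : 0 < T := h0.trans h1
  have hmT : 0 ≤ m * T := by positivity
  obtain ⟨v, hv, hvi⟩ := multi hV h0 h1 hw hw0 m
  obtain ⟨r1, hr1⟩ := hK (u a) (-deriv u a) ua (by simpa using da)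
  obtain ⟨r2, hr2⟩ := hK (u b) (deriv u b) ub db
  have hr1' := hr1.reverse.shift a
  simp only [neg_neg, neg_zero, zero_add] at hr1'
  have hv' := hv.shift (a + 1)
  rw [zero_add] at hv'
  have hr2' := hr2.shift (b - 1)
  rw [zero_add, show 1 + (b - 1) = b by ring] at hr2'
  have hu1 : IsPath V A a (u A) (deriv u A) (u a) (deriv u a) (energy V A a u) u :=
    ⟨hu, rfl, rfl, rfl, rfl, le_rfl⟩
  have hu2 : IsPath V b B (u b) (deriv u b) (u B) (deriv u B) (energy V b B u) u :=
    ⟨hu, rfl, rfl, rfl, rfl, le_rfl⟩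
  obtain ⟨w1, hw1, -, -⟩ := hu1.trans hc (by linarith) (by linarith) hr1'
  rw [add_comm 1 a] at hw1
  obtain ⟨w2, hw2, -, w2r⟩ := hw1.trans hc (by linarith) (by linarith) hv'
  obtain ⟨w3, hw3, w3l, -⟩ := hw2.trans hc (by linarith) (by linarith)
    (IsPath.const (V_one hV) (m * T + (a + 1)) (b - 1))
  obtain ⟨w4, hw4, w4l, -⟩ := hw3.trans hc (by linarith) (by linarith) hr2'
  obtain ⟨w5, hw5, w5l, -⟩ := hw4.trans hc (by linarith) (by linarith) hu2
  have hval : ∀ y, 0 ≤ y → y ≤ m * T → w5 (a + 1 + y) = v y := by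
    intro y hy0 hy1
    rw [w5l _ (by linarith), w4l _ (by linarith), w3l _ (by linarith), w2r _ (by linarith)]
    congr 1; ring
  refine ⟨w5, hw5.1, hw5.2.1, hw5.2.2.2.1, ⟨fun i => a + 1 + i * T, fun i => a + 1 + (i * T + x₀),
    fun i => a + 1 + (i + 1) * T, ?_, ?_⟩, ?_⟩
  · intro i hi
    obtain ⟨q1, q2, q3⟩ := hvi i hi
    have hi' : (i:ℝ) + 1 ≤ m := by exact_mod_cast hi
    have hle : ((i:ℝ) + 1) * T ≤ m * T := mul_le_mul_of_nonneg_right hi' hT.le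
    have hi0 : 0 ≤ (i:ℝ) * T := by positivity
    refine ⟨by linarith, by linarith, by linarith, by linarith, ?_, Or.inl ⟨?_, ?_⟩⟩
    · rw [hval _ (by linarith) (by linarith), q2]; simpa using hδ.le
    · rw [hval _ (by linarith) (by linarith), q1]; simpa using hδ.le
    · rw [hval _ (by linarith) (by linarith), q3]; simpa using hδ.le
  · intro i _
    push_cast
    exact le_rfl
  · refine hw5.2.2.2.2.2.trans ?_
    have e1 := energy_add hc hu A a b
    have e2 := energy_add hc hu A b B
    have e3 := energy_nonneg hV.nonneg (show a ≤ b by linarith) u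
    linarith

lemma low_point {V : ℝ → ℝ} (hV : Assumption1 V) {u : ℝ → ℝ} (hu : ContDiff ℝ 1 u)
    {A B a b κ : ℝ} (hA : A ≤ a) (hab : a ≤ b) (hB : b ≤ B)
    (hE : energy V A B u < κ * (b - a)) :
    ∃ x ∈ Set.Icc a b, 1/2 * (deriv u x)^2 + V (u x) < κ := by
  have hc : Continuous V := hV.smooth.continuous
  by_contra! hcon
  have h1 : ∫ x in a..b, κ ≤ energy V a b u :=
    intervalIntegral.integral_mono_on hab intervalIntegrable_const
      ((dens_cont hc hu).intervalIntegrable _ _) hcon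
  rw [intervalIntegral.integral_const, smul_eq_mul] at h1
  have e1 := energy_add hc hu A a b
  have e2 := energy_add hc hu A b B
  have e3 := energy_nonneg hV.nonneg hA u
  have e4 := energy_nonneg hV.nonneg hB u
  linarith

lemma comp_bound {V : ℝ → ℝ} (hV : Assumption1 V) (M : ℝ) :
    ∃ K > 0, ∀ A B, A + 2 ≤ B → ∀ um ∈ Set.Icc (-M) M, ∀ up ∈ Set.Icc (-M) M,
      ∃ u : ℝ → ℝ, ContDiff ℝ 1 u ∧ u A = um ∧ u B = up ∧ energy V A B u ≤ K := by
  have hc : Continuous V := hV.smooth.continuous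
  set D := 2 * (|M| + 1) with hD
  have hDp : 0 < D := by positivity
  obtain ⟨S, hS0, hS⟩ := V_bdd hc (1 + D)
  refine ⟨2 * (1/2 * D^2 + S), by positivity, ?_⟩
  intro A B hAB um hum up hup
  have hh : ∀ p ∈ Set.Icc (-M) M, ∃ w, IsPath V 0 1 1 0 p 0 (1 * (1/2 * D^2 + S)) w := by
    intro p hp
    refine hermite hc 1 0 p 0 1 D S one_pos ?_ fun v hv => hS v ?_
    · have : |p| ≤ |M| := (abs_le.2 hp).trans (le_abs_self M)
      have := abs_sub p 1
      simp at this ⊢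
      linarith
    · have := abs_add_le (v - 1) 1
      simp at this hv
      linarith
  obtain ⟨a1, h1⟩ := hh um hum
  obtain ⟨a2, h2⟩ := hh up hup
  have h1' := h1.reverse.shift A
  simp only [neg_zero, zero_add] at h1'
  have h2' := h2.shift (B - 1)
  rw [zero_add, show 1 + (B - 1) = B by ring] at h2'
  obtain ⟨w1, hw1, -, -⟩ := h1'.trans hc (by linarith) (by linarith)
    (IsPath.const (V_one hV) (1 + A) (B - 1))
  obtain ⟨w, hw, -, -⟩ := hw1.trans hc (by linarith) (by linarith) h2'
  exact ⟨w, hw.1, hw.2.1, hw.2.2.2.1, hw.2.2.2.2.2.trans (by linarith)⟩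

set_option maxHeartbeats 1000000 in
/-- Per-excursion cost of several wasted excursions (Lemma 4.4): requiring `m` disjoint wasted
`δ⁻` excursions in `(−ℓ₁, ℓ₁)` raises the minimal energy on `(−ℓ₁−ℓ₂, ℓ₁+ℓ₂)` by at most
`m (c₀ + Cδ)`, uniformly over boundary values in `[−M, M]`. -/
theorem multiple_wasted_excursions_cost
    (V : ℝ → ℝ) (hV : Assumption1 V) :
    ∃ C : ℝ, 0 < C ∧
      ∀ M : ℝ, ∀ δ : ℝ, δ ∈ Set.Ioo (0:ℝ) (1/2) → ∀ m : ℕ, 1 ≤ m →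
        ∃ lstar : ℝ, ∀ ℓ₁ ℓ₂ : ℝ, lstar ≤ ℓ₁ → lstar ≤ ℓ₂ →
          ∀ um up : ℝ, um ∈ Set.Icc (-M) M → up ∈ Set.Icc (-M) M →
            sInf {e : ℝ | ∃ u : ℝ → ℝ, ContDiff ℝ 1 u ∧
                u (-(ℓ₁+ℓ₂)) = um ∧ u (ℓ₁+ℓ₂) = up ∧
                (∃ xm x0 xp : ℕ → ℝ,
                  (∀ i < m, -ℓ₁ ≤ xm i ∧ xm i < x0 i ∧ x0 i < xp i ∧ xp i ≤ ℓ₁ ∧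
                    IsWastedMinusTriple δ u (xm i) (x0 i) (xp i)) ∧
                  (∀ i, i + 1 < m → xp i ≤ xm (i+1))) ∧
                e = energy V (-(ℓ₁+ℓ₂)) (ℓ₁+ℓ₂) u} -
            sInf {e : ℝ | ∃ u : ℝ → ℝ, ContDiff ℝ 1 u ∧
                u (-(ℓ₁+ℓ₂)) = um ∧ u (ℓ₁+ℓ₂) = up ∧
                e = energy V (-(ℓ₁+ℓ₂)) (ℓ₁+ℓ₂) u} ≤
            m * (c0 V + C * δ) := by
  have hc : Continuous V := hV.smooth.continuous
  obtain ⟨K₁, hK₁, hexc⟩ := excursion hV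
  obtain ⟨K₂, hK₂, hmatch⟩ := match_path hV
  refine ⟨K₁ + 2 * K₂ + 1, by positivity, ?_⟩
  intro M δ hδ m hm
  obtain ⟨T, x₀, w₀, hx0, hx1, hw₀, hw₀0⟩ := hexc δ hδ
  obtain ⟨K, hK, hcomp⟩ := comp_bound hV M
  obtain ⟨κ₀, hκ₀, hsmall⟩ := V_small hV hδ.1 hδ.2
  have hT : 0 < T := hx0.trans hx1
  have hδ0 := hδ.1
  set κ := min κ₀ (δ^2/2) with hκ
  have hκp : 0 < κ := lt_min hκ₀ (by positivity)
  set lam := (K + 2) / κ with hlam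
  have hlamp : 0 < lam := by positivity
  have hm0 : 0 ≤ m * T := by positivity
  refine ⟨m * T + 2 + 2 * lam, ?_⟩
  intro ℓ₁ ℓ₂ hl1 hl2 um up hum hup
  set A := -(ℓ₁ + ℓ₂) with hA
  set B := ℓ₁ + ℓ₂ with hB
  set S₀ := {e : ℝ | ∃ u : ℝ → ℝ, ContDiff ℝ 1 u ∧
                u A = um ∧ u B = up ∧
                (∃ xm x0 xp : ℕ → ℝ,
                  (∀ i < m, -ℓ₁ ≤ xm i ∧ xm i < x0 i ∧ x0 i < xp i ∧ xp i ≤ ℓ₁ ∧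
                    IsWastedMinusTriple δ u (xm i) (x0 i) (xp i)) ∧
                  (∀ i, i + 1 < m → xp i ≤ xm (i+1))) ∧
                e = energy V A B u} with hS₀
  set S := {e : ℝ | ∃ u : ℝ → ℝ, ContDiff ℝ 1 u ∧
                u A = um ∧ u B = up ∧
                e = energy V A B u} with hS
  have hAB : A ≤ B := by linarith
  have bS₀ : BddBelow S₀ := ⟨0, by
    rintro e ⟨u, _, _, _, _, rfl⟩; exact energy_nonneg hV.nonneg hAB u⟩
  have bS : BddBelow S := ⟨0, by
    rintro e ⟨u, _, _, _, rfl⟩; exact energy_nonneg hV.nonneg hAB u⟩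
  obtain ⟨z, hz, hzA, hzB, hzE⟩ := hcomp A B (by linarith) um hum up hup
  have hzS : energy V A B z ∈ S := ⟨z, hz, hzA, hzB, rfl⟩
  have hinf : sInf S ≤ K := (csInf_le bS hzS).trans hzE
  obtain ⟨e, ⟨u, hu, huA, huB, rfl⟩, hlt⟩ := exists_lt_of_csInf_lt ⟨_, hzS⟩
    (show sInf S < sInf S + δ by linarith)
  have hEu : energy V A B u < κ * lam := by
    rw [hlam, mul_div_cancel₀ _ hκp.ne']
    linarith [hδ.2]
  have good : ∀ x, 1/2 * (deriv u x)^2 + V (u x) < κ →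
      |deriv u x| ≤ δ ∧ (|u x - 1| ≤ δ ∨ |u x + 1| ≤ δ) := by
    intro x hx
    have h1 : κ ≤ κ₀ := min_le_left _ _
    have h2 : κ ≤ δ^2/2 := min_le_right _ _
    have h3 := hV.nonneg (u x)
    refine ⟨abs_le_of_sq_le_sq (by linarith) hδ0.le, hsmall _ ?_⟩
    have := sq_nonneg (deriv u x)
    linarith
  -- two points on the same side suffice
  have fin : ∀ a b, -ℓ₁ ≤ a → a + (m * T + 2) ≤ b → b ≤ ℓ₁ → |deriv u a| ≤ δ → |deriv u b| ≤ δ →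
      ((|u a - 1| ≤ δ ∧ |u b - 1| ≤ δ) ∨ (|u a + 1| ≤ δ ∧ |u b + 1| ≤ δ)) →
      sInf S₀ - sInf S ≤ m * (c0 V + (K₁ + 2 * K₂ + 1) * δ) := by
    intro a b ha hab hb da db hcase
    have hm1 : (1:ℝ) ≤ m := by exact_mod_cast hm
    have harith : ∀ E, E ≤ energy V A B u + m * (c0 V + K₁ * δ) + 2 * (K₂ * δ) →
        E - sInf S ≤ m * (c0 V + (K₁ + 2 * K₂ + 1) * δ) := by
      intro E hE
      have hp : 0 ≤ (2 * K₂ + 1) * δ := by positivity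
      have := mul_le_mul_of_nonneg_right hm1 hp
      linarith
    rcases hcase with ⟨ua, ub⟩ | ⟨ua, ub⟩
    · obtain ⟨w, hw, wA, wB, hex, hE⟩ := replace_one hV hδ0 (hmatch δ hδ) hx0 hx1 hw₀ hw₀0 m
        hu (A := A) (B := B) (ℓ := ℓ₁) (by linarith) ha hab hb (by linarith) ua da ub db
      have hmem : energy V A B w ∈ S₀ := ⟨w, hw, wA.trans huA, wB.trans huB, hex, rfl⟩
      exact harith _ ((csInf_le bS₀ hmem).trans hE)
    · have hd : ∀ x, deriv (fun x => - u x) x = - deriv u x := fun x => deriv.fun_neg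
      have hn : ∀ y : ℝ, |-y - 1| = |y + 1| := fun y => by rw [← abs_neg]; congr 1; ring
      have hn' : ∀ y : ℝ, |-y + 1| = |y - 1| := fun y => by rw [← abs_neg]; congr 1; ring
      obtain ⟨w, hw, wA, wB, ⟨xm, x0, xp, hx, hxx⟩, hE⟩ :=
        replace_one hV hδ0 (hmatch δ hδ) hx0 hx1 hw₀ hw₀0 m
        (u := fun x => - u x) hu.neg (A := A) (B := B) (ℓ := ℓ₁) (by linarith) ha hab hb
        (by linarith) (by rwa [hn]) (by rwa [hd, abs_neg]) (by rwa [hn]) (by rwa [hd, abs_neg])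
      rw [energy_neg hV.even] at hE
      have hmem : energy V A B (fun x => - w x) ∈ S₀ := by
        refine ⟨fun x => - w x, hw.neg, by simp [wA, huA], by simp [wB, huB],
          ⟨xm, x0, xp, fun i hi => ?_, hxx⟩, rfl⟩
        obtain ⟨g1, g2, g3, g4, g5, g6⟩ := hx i hi
        refine ⟨g1, g2, g3, g4, by simpa using g5, ?_⟩
        simp only [hn, hn']
        exact g6.symm
      rw [energy_neg hV.even] at hmem
      exact harith _ ((csInf_le bS₀ hmem).trans hE)
  obtain ⟨a, ha, ha'⟩ := low_point hV hu (A := A) (B := B) (a := -ℓ₁) (b := -ℓ₁ + lam) (κ := κ)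
    (by linarith) (by linarith) (by linarith) (by simpa using hEu)
  obtain ⟨b, hb, hb'⟩ := low_point hV hu (A := A) (B := B) (a := -(lam/2)) (b := lam/2) (κ := κ)
    (by linarith) (by linarith) (by linarith) (by simpa using hEu)
  obtain ⟨c, hcc, hc'⟩ := low_point hV hu (A := A) (B := B) (a := ℓ₁ - lam) (b := ℓ₁) (κ := κ)
    (by linarith) (by linarith) (by linarith) (by simpa using hEu)
  obtain ⟨da, ua⟩ := good a ha'
  obtain ⟨db, ub⟩ := good b hb'
  obtain ⟨dc, uc⟩ := good c hc'
  have ab := fin a b (by linarith [ha.1]) (by linarith [ha.2, hb.1]) (by linarith [hb.2]) da db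
  have bc := fin b c (by linarith [hb.1]) (by linarith [hb.2, hcc.1]) (by linarith [hcc.2]) db dc
  have ac := fin a c (by linarith [ha.1]) (by linarith [ha.2, hcc.1]) (by linarith [hcc.2]) da dc
  rcases ua with ua | ua
  · rcases ub with ub | ub
    · exact ab (Or.inl ⟨ua, ub⟩)
    · rcases uc with uc | uc
      · exact ac (Or.inl ⟨ua, uc⟩)
      · exact bc (Or.inr ⟨ub, uc⟩)
  · rcases ub with ub | ub
    · rcases uc with uc | uc
      · exact bc (Or.inl ⟨ub, uc⟩)
      · exact ac (Or.inr ⟨ua, uc⟩)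
    · exact ab (Or.inr ⟨ua, ub⟩)
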